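/- Let a₁,…,a_{N₁}, b₁,…,b_{N₂} ∈ ℂ be pairwise distinct. Let φⁱ, ψʲ : ℝ³ → Matrix n n ℂ be smooth and invertible at every point of (ξ, η, ν)-space, and let Ūⁱ, V̄ʲ : ℝ³ → Matrix n n ℂ be smooth with ∂_η Ūⁱ = ∂_ν Ūⁱ = 0 and ∂_ξ V̄ʲ = ∂_ν V̄ʲ = 0. Define Uⁱ := φⁱ Ūⁱ (φⁱ)⁻¹ and Vʲ := ψʲ V̄ʲ (ψʲ)⁻¹, and for μ not a pole put U(μ) := Σᵢ Uⁱ/(μ − aᵢ) and V(μ) := Σⱼ Vʲ/(μ − b_j). Suppose (the W̄ = 0 reduction of the multiform Euler–Lagrange equations): ∂_η φⁱ = V(aᵢ) φⁱ, ∂_ν φⁱ = 0, ∂_ξ ψʲ = U(b_j) ψʲ, and ∂_ν ψʲ = 0 on ℝ³. Then ∂_ν Uⁱ = 0 and ∂_ν Vʲ = 0 for all i, j, and the compatibility conditions hold: ∂_η Uⁱ + [Uⁱ, Σⱼ Vʲ/(aᵢ − b_j)] = 0 for each i, and ∂_ξ Vʲ + [Vʲ, Σᵢ Uⁱ/(b_j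 − aᵢ)] = 0 for each j. -/

import Mathlib

open Matrix

attribute [local instance] Matrix.linftyOpNormedAddCommGroup Matrix.linftyOpNormedSpace
  Matrix.linftyOpNormedRing

/-- Partial derivative in the first of three real variables (`ξ`). -/
noncomputable def pdx {E : Type*} [NormedAddCommGroup E] [NormedSpace ℝ E]
    (f : ℝ → ℝ → ℝ → E) (x y z : ℝ) : E :=
  deriv (fun t => f t y z) x

/-- Partial derivative in the second of three real variables (`η`). -/
noncomputable def pdy {E : Type*} [NormedAddCommGroup E] [NormedSpace ℝ E]
    (f : ℝ → ℝ → ℝ → E) (x y z : ℝ) : E :=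
  deriv (fun t => f x t z) y

/-- Partial derivative in the third of three real variables (`ν`). -/
noncomputable def pdz {E : Type*} [NormedAddCommGroup E] [NormedSpace ℝ E]
    (f : ℝ → ℝ → ℝ → E) (x y z : ℝ) : E :=
  deriv (fun t => f x y t) z

/-- Smoothness (infinite differentiability) of a function of three real variables. -/
def Smooth3 {E : Type*} [NormedAddCommGroup E] [NormedSpace ℝ E]
    (f : ℝ → ℝ → ℝ → E) : Prop :=
  ContDiff ℝ (⊤ : ℕ∞) (fun p : ℝ × ℝ × ℝ => f p.1 p.2.1 p.2.2)

theorem conj_deriv_gen {R : Type*} [NormedRing R] [NormedAlgebra ℝ R] [CompleteSpace R]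
    (g w : ℝ → R) (t : ℝ) (A : R) (hg : HasDerivAt g (A * g t) t) (hw : HasDerivAt w 0 t)
    (hu : IsUnit (g t)) :
    HasDerivAt (fun s => g s * w s * Ring.inverse (g s))
      (A * (g t * w t * Ring.inverse (g t)) - g t * w t * Ring.inverse (g t) * A) t := by
  obtain ⟨u, hu⟩ := hu
  have h1 : HasFDerivAt Ring.inverse (-ContinuousLinearMap.mulLeftRight ℝ R ↑u⁻¹ ↑u⁻¹) (g t) := by
    rw [← hu]; exact hasFDerivAt_ringInverse (𝕜 := ℝ) u
  have h2 := h1.comp_hasDerivAt t hg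
  have h3 := (hg.mul hw).mul h2
  refine h3.congr_deriv ?_
  simp [← hu, mul_assoc, sub_eq_add_neg]

theorem conj_deriv_mat {n : Type*} [Fintype n] [DecidableEq n]
    (g w X : ℝ → Matrix n n ℂ) (t : ℝ) (A : Matrix n n ℂ)
    (hX : ∀ s, X s = g s * w s * (g s)⁻¹)
    (hgd : DifferentiableAt ℝ g t) (hwd : DifferentiableAt ℝ w t)
    (hg : deriv g t = A * g t) (hw : deriv w t = 0) (hu : IsUnit (g t)) :
    deriv X t + (X t * A - A * X t) = 0 := by
  let _ : NormedAlgebra ℝ (Matrix n n ℂ) := Matrix.linftyOpNormedAlgebra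
  have : CompleteSpace (Matrix n n ℂ) := FiniteDimensional.complete ℝ _
  have h1 := hgd.hasDerivAt.congr_deriv hg
  have h2 := hwd.hasDerivAt.congr_deriv hw
  have h := conj_deriv_gen g w t A h1 h2 hu
  have hX' : X = fun s => g s * w s * Ring.inverse (g s) := by
    funext s; rw [hX, Matrix.nonsing_inv_eq_ringInverse]
  have h3 : deriv X t = A * X t - X t * A := by
    rw [hX']; exact h.deriv
  rw [h3]; abel

theorem smooth3_dx {E : Type*} [NormedAddCommGroup E] [NormedSpace ℝ E]
    {f : ℝ → ℝ → ℝ → E} (h : Smooth3 f) (x y z : ℝ) :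
    DifferentiableAt ℝ (fun t => f t y z) x :=
  ((h.differentiable (by simp)).comp
    (by fun_prop : Differentiable ℝ (fun t : ℝ => ((t, y, z) : ℝ × ℝ × ℝ)))) x

theorem smooth3_dy {E : Type*} [NormedAddCommGroup E] [NormedSpace ℝ E]
    {f : ℝ → ℝ → ℝ → E} (h : Smooth3 f) (x y z : ℝ) :
    DifferentiableAt ℝ (fun t => f x t z) y :=
  ((h.differentiable (by simp)).comp
    (by fun_prop : Differentiable ℝ (fun t : ℝ => ((x, t, z) : ℝ × ℝ × ℝ)))) y

theorem smooth3_dz {E : Type*} [NormedAddCommGroup E] [NormedSpace ℝ E]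
    {f : ℝ → ℝ → ℝ → E} (h : Smooth3 f) (x y z : ℝ) :
    DifferentiableAt ℝ (fun t => f x y t) z :=
  ((h.differentiable (by simp)).comp
    (by fun_prop : Differentiable ℝ (fun t : ℝ => ((x, y, t) : ℝ × ℝ × ℝ)))) z

/-- The `W̄ = 0` reduction of the multiform Euler–Lagrange equations: all
solutions become independent of the ghost direction `ν` and satisfy the
zero-curvature compatibility conditions of the auxiliary problem. -/
theorem ghost_direction_reduction {n : Type*} [Fintype n] [DecidableEq n]
    {N1 N2 : ℕ} (a : Fin N1 → ℂ) (b : Fin N2 → ℂ)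
    (ha : Function.Injective a) (hb : Function.Injective b)
    (hab : ∀ i j, a i ≠ b j)
    (φ : Fin N1 → ℝ → ℝ → ℝ → Matrix n n ℂ)
    (ψ : Fin N2 → ℝ → ℝ → ℝ → Matrix n n ℂ)
    (Ubar : Fin N1 → ℝ → ℝ → ℝ → Matrix n n ℂ)
    (Vbar : Fin N2 → ℝ → ℝ → ℝ → Matrix n n ℂ)
    (hφ : ∀ i, Smooth3 (φ i)) (hψ : ∀ j, Smooth3 (ψ j))
    (hφinv : ∀ i ξ η ν, IsUnit (φ i ξ η ν))
    (hψinv : ∀ j ξ η ν, IsUnit (ψ j ξ η ν))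
    (hUbar : ∀ i, Smooth3 (Ubar i)) (hVbar : ∀ j, Smooth3 (Vbar j))
    (hUbarη : ∀ i ξ η ν, pdy (Ubar i) ξ η ν = 0)
    (hUbarν : ∀ i ξ η ν, pdz (Ubar i) ξ η ν = 0)
    (hVbarξ : ∀ j ξ η ν, pdx (Vbar j) ξ η ν = 0)
    (hVbarν : ∀ j ξ η ν, pdz (Vbar j) ξ η ν = 0)
    (U : Fin N1 → ℝ → ℝ → ℝ → Matrix n n ℂ)
    (V : Fin N2 → ℝ → ℝ → ℝ → Matrix n n ℂ)
    (hU : ∀ i ξ η ν, U i ξ η ν = φ i ξ η ν * Ubar i ξ η ν * (φ i ξ η ν)⁻¹)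
    (hV : ∀ j ξ η ν, V j ξ η ν = ψ j ξ η ν * Vbar j ξ η ν * (ψ j ξ η ν)⁻¹)
    (hφη : ∀ i ξ η ν, pdy (φ i) ξ η ν
      = (∑ j, (a i - b j)⁻¹ • V j ξ η ν) * φ i ξ η ν)
    (hφν : ∀ i ξ η ν, pdz (φ i) ξ η ν = 0)
    (hψξ : ∀ j ξ η ν, pdx (ψ j) ξ η ν
      = (∑ i, (b j - a i)⁻¹ • U i ξ η ν) * ψ j ξ η ν)
    (hψν : ∀ j ξ η ν, pdz (ψ j) ξ η ν = 0) :
    (∀ i ξ η ν, pdz (U i) ξ η ν = 0)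
    ∧ (∀ j ξ η ν, pdz (V j) ξ η ν = 0)
    ∧ (∀ i ξ η ν, pdy (U i) ξ η ν
        + (U i ξ η ν * (∑ j, (a i - b j)⁻¹ • V j ξ η ν)
          - (∑ j, (a i - b j)⁻¹ • V j ξ η ν) * U i ξ η ν) = 0)
    ∧ (∀ j ξ η ν, pdx (V j) ξ η ν
        + (V j ξ η ν * (∑ i, (b j - a i)⁻¹ • U i ξ η ν)
          - (∑ i, (b j - a i)⁻¹ • U i ξ η ν) * V j ξ η ν) = 0) := by
  refine ⟨fun i x y z => ?_, fun j x y z => ?_, fun i x y z => ?_, fun j x y z => ?_⟩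
  · have := conj_deriv_mat (fun t => φ i x y t) (fun t => Ubar i x y t) (fun t => U i x y t) z 0
      (fun s => hU i x y s) (smooth3_dz (hφ i) x y z) (smooth3_dz (hUbar i) x y z)
      ((hφν i x y z).trans (zero_mul _).symm) (hUbarν i x y z) (hφinv i x y z)
    rw [mul_zero, zero_mul, sub_zero, add_zero] at this
    exact this
  · have := conj_deriv_mat (fun t => ψ j x y t) (fun t => Vbar j x y t) (fun t => V j x y t) z 0
      (fun s => hV j x y s) (smooth3_dz (hψ j) x y z) (smooth3_dz (hVbar j) x y z)
      ((hψν j x y z).trans (zero_mul _).symm) (hVbarν j x y z) (hψinv j x y z)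
    rw [mul_zero, zero_mul, sub_zero, add_zero] at this
    exact this
  · exact conj_deriv_mat (fun t => φ i x t z) (fun t => Ubar i x t z) (fun t => U i x t z) y _
      (fun s => hU i x s z) (smooth3_dy (hφ i) x y z) (smooth3_dy (hUbar i) x y z)
      (hφη i x y z) (hUbarη i x y z) (hφinv i x y z)
  · exact conj_deriv_mat (fun t => ψ j t y z) (fun t => Vbar j t y z) (fun t => V j t y z) x _
      (fun s => hV j s y z) (smooth3_dx (hψ j) x y z) (smooth3_dx (hVbar j) x y z)
      (hψξ j x y z) (hVbarξ j x y z) (hψinv j x y z)
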